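/- arXiv:2502.03018 — 3 statements merged into one kernel-verified Lean document; each statement's English description precedes it below -/
import Mathlib

section
/- Let (τ_n)_{n≥1} be a sequence of complex numbers with ∑_{n=1}^∞ |τ_n| < ∞, and let (γ_n)_{n≥1} be a sequence of real numbers with 0 ≤ γ_1 < γ_2 < ⋯ and γ_n → ∞. Define F : ℂ⁺ → ℂ by F(z) = ∑_{n=1}^∞ τ_n e^{-γ_n z}. If the zero set { z ∈ ℂ⁺ : F(z) = 0 } has an accumulation point in ℂ⁺ (i.e., some point of ℂ⁺ is a limit of a sequence of distinct zeros of F in ℂ⁺), then τ_n = 0 for every n ≥ 1. -/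
open Complex Filter

theorem norm_mul_cexp_neg_mul_le (a : ℂ) {c : ℝ} {z : ℂ} (hc : 0 ≤ c) (hz : 0 ≤ z.re) :
    ‖a * Complex.exp (-(c : ℂ) * z)‖ ≤ ‖a‖ := by
  rw [norm_mul, Complex.norm_exp]
  refine mul_le_of_le_one_right (norm_nonneg a) (Real.exp_le_one_iff.2 ?_)
  simpa using mul_nonneg hc hz

theorem differentiableOn_tsum_mul_cexp {τ : ℕ → ℂ} {γ : ℕ → ℝ}
    (hτ : Summable fun n => ‖τ n‖) (hγ : ∀ n, 0 ≤ γ n) :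
    DifferentiableOn ℂ (fun z => ∑' n, τ n * Complex.exp (-(γ n : ℂ) * z)) {z | 0 < z.re} := by
  refine Complex.differentiableOn_tsum_of_summable_norm hτ (fun n => by fun_prop)
    (isOpen_lt continuous_const Complex.continuous_re) fun n z hz => ?_
  exact norm_mul_cexp_neg_mul_le _ (hγ n) (le_of_lt hz)

/-- The leading coefficient of a generalized Dirichlet series is recovered as the limit of the
rescaled series along the positive real axis. -/
theorem tendsto_cexp_mul_tsum_mul_cexp {τ : ℕ → ℂ} {γ : ℕ → ℝ}
    (hτ : Summable fun n => ‖τ n‖) (hγ : StrictMono γ) {n : ℕ} (hn : ∀ k < n, τ k = 0) :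
    Tendsto (fun x : ℝ => Complex.exp (γ n * x) * ∑' k, τ k * Complex.exp (-(γ k : ℂ) * x))
      atTop (nhds (τ n)) := by
  have hlim : Tendsto
      (fun x : ℝ => ∑' k, τ k * Complex.exp (-((γ k - γ n : ℝ) : ℂ) * x)) atTop
      (nhds (∑' k, if k = n then τ n else 0)) := by
    refine tendsto_tsum_of_dominated_convergence hτ (fun k => ?_) ?_
    · rcases lt_trichotomy k n with h | rfl | h
      · simp [hn k h, h.ne]
      · simp
      · have hpos : 0 < γ k - γ n := sub_pos.2 (hγ h)
        rw [if_neg h.ne', tendsto_zero_iff_norm_tendsto_zero]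
        have hexp : Tendsto (fun x : ℝ => Real.exp (-((γ k - γ n) * x))) atTop (nhds 0) :=
          Real.tendsto_exp_neg_atTop_nhds_zero.comp (tendsto_id.const_mul_atTop hpos)
        simpa [Complex.norm_exp, ← neg_mul] using hexp.const_mul ‖τ k‖
    · filter_upwards [eventually_ge_atTop 0] with x hx k
      rcases lt_or_ge k n with h | h
      · simp [hn k h]
      · exact norm_mul_cexp_neg_mul_le _ (sub_nonneg.2 (hγ.monotone h)) (by simpa using hx)
  rw [tsum_ite_eq] at hlim
  refine hlim.congr fun x => ?_
  rw [← tsum_mul_left]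
  refine tsum_congr fun k => ?_
  rw [mul_left_comm, ← Complex.exp_add]
  congr 2
  push_cast
  ring

/-- Lemma 3.4: if the zero set of the Dirichlet-type series
`F(z) = ∑ τ_n e^{-γ_n z}` has an accumulation point in the open right half-plane,
then all coefficients vanish. -/
theorem dirichlet_series_zero_accumulation
    (τ : ℕ → ℂ) (γ : ℕ → ℝ)
    (hτ : Summable fun n => ‖τ n‖)
    (hγ0 : 0 ≤ γ 0) (hγmono : StrictMono γ)
    (hγtop : Tendsto γ atTop atTop)
    (hacc : ∃ z₀ : ℂ, 0 < z₀.re ∧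
      AccPt z₀ (Filter.principal
        {z : ℂ | 0 < z.re ∧ (∑' n, τ n * Complex.exp (-(γ n : ℂ) * z)) = 0})) :
    ∀ n, τ n = 0 := by
  obtain ⟨z₀, hz₀, hacc⟩ := hacc
  have hγ : ∀ n, 0 ≤ γ n := fun n => hγ0.trans (hγmono.monotone n.zero_le)
  have hzero := ((differentiableOn_tsum_mul_cexp hτ hγ).analyticOnNhd
    (isOpen_lt continuous_const Complex.continuous_re)).eqOn_zero_of_preconnected_of_frequently_eq_zero
    (convex_halfSpace_re_gt 0).isPreconnected hz₀
    ((accPt_iff_frequently_nhdsNE.1 hacc).mono fun z hz => hz.2)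
  intro n
  induction n using Nat.strong_induction_on with
  | _ n ih =>
    refine tendsto_nhds_unique (tendsto_cexp_mul_tsum_mul_cexp hτ hγmono ih)
      (tendsto_const_nhds.congr' ?_)
    filter_upwards [eventually_gt_atTop 0] with x hx
    have hx0 : (∑' k, τ k * Complex.exp (-(γ k : ℂ) * x)) = 0 :=
      hzero (show 0 < ((x : ℂ)).re by simpa using hx)
    rw [hx0, mul_zero]
end

section
/- Let (τ_n)_{n≥1} be a sequence of complex numbers with ∑_{n=1}^∞ |τ_n| < ∞, and let (γ_n)_{n≥1} be a sequence of real numbers with 0 ≤ γ_1 < γ_2 < ⋯ and γ_n → ∞. If there exist real numbers 0 < a < b such that ∑_{n=1}^∞ τ_n e^{-γ_n t} = 0 for every real t ∈ (a,b), then τ_n = 0 for every n ≥ 1. -/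
open Complex Filter

/-- An absolutely summable Dirichlet series with nonnegative exponents is holomorphic on the open
right half-plane. -/
lemma differentiableOn_tsum_mul_exp_neg_mul {τ : ℕ → ℂ} {γ : ℕ → ℝ}
    (hτ : Summable fun n => ‖τ n‖) (hγ : ∀ n, 0 ≤ γ n) :
    DifferentiableOn ℂ (fun z : ℂ => ∑' n, τ n * Complex.exp (-(γ n : ℂ) * z)) {z | 0 < z.re} := by
  refine differentiableOn_tsum_of_summable_norm hτ (fun n => by fun_prop)
    (isOpen_lt continuous_const continuous_re) fun n z hz => ?_
  rw [norm_mul, norm_exp]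
  refine mul_le_of_le_one_right (norm_nonneg _) (Real.exp_le_one_iff.2 ?_)
  have := mul_nonneg (hγ n) (le_of_lt hz)
  simpa using this

/-- If all coefficients before the `n`-th vanish, the `n`-th coefficient is the limit at infinity of
the Dirichlet series normalized by `e^{γ_n t}`. -/
lemma tendsto_exp_mul_tsum_mul_exp_neg_mul {τ : ℕ → ℂ} {γ : ℕ → ℝ}
    (hτ : Summable fun n => ‖τ n‖) (hγ : StrictMono γ) {n : ℕ} (hn : ∀ m < n, τ m = 0) :
    Tendsto (fun t : ℝ => Complex.exp (γ n * t) * ∑' k, τ k * Complex.exp (-(γ k : ℂ) * t))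
      atTop (nhds (τ n)) := by
  have key (t : ℝ) (k : ℕ) : Complex.exp (γ n * t) * (τ k * Complex.exp (-(γ k : ℂ) * t)) =
      τ k * (Real.exp (-((γ k - γ n) * t)) : ℝ) := by
    rw [mul_left_comm, ← Complex.exp_add]
    push_cast
    ring_nf
  simp_rw [← tsum_mul_left, key]
  rw [← tsum_ite_eq n τ]
  refine tendsto_tsum_of_dominated_convergence hτ (fun k => ?_) ?_
  · rcases lt_trichotomy k n with h | rfl | h
    · simp [hn k h, h.ne]
    · simp
    · rw [if_neg h.ne']
      have h1 : Tendsto (fun t : ℝ => Real.exp (-((γ k - γ n) * t))) atTop (nhds 0) :=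
        Real.tendsto_exp_neg_atTop_nhds_zero.comp
          (tendsto_id.const_mul_atTop (sub_pos.2 (hγ h)))
      simpa using ((continuous_ofReal.tendsto 0).comp h1).const_mul (τ k)
  · filter_upwards [eventually_ge_atTop 0] with t ht k
    rcases lt_or_ge k n with h | h
    · simp [hn k h]
    · rw [norm_mul, norm_real, Real.norm_of_nonneg (Real.exp_nonneg _)]
      refine mul_le_of_le_one_right (norm_nonneg _) (Real.exp_le_one_iff.2 ?_)
      exact neg_nonpos.2 (mul_nonneg (sub_nonneg.2 (hγ.monotone h)) ht)

/-- If the Dirichlet-type series `∑ τ_n e^{-γ_n t}` vanishes on a real interval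
`(a,b)` with `0 < a < b`, then all coefficients vanish. -/
theorem dirichlet_series_vanishing_on_interval
    (τ : ℕ → ℂ) (γ : ℕ → ℝ)
    (hτ : Summable fun n => ‖τ n‖)
    (hγ0 : 0 ≤ γ 0) (hγmono : StrictMono γ)
    (hγtop : Tendsto γ atTop atTop)
    (a b : ℝ) (ha : 0 < a) (hab : a < b)
    (hzero : ∀ t : ℝ, a < t → t < b →
      (∑' n, τ n * Complex.exp (-(γ n : ℂ) * (t : ℂ))) = 0) :
    ∀ n, τ n = 0 := by
  have han := (differentiableOn_tsum_mul_exp_neg_mul hτ fun n =>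
    hγ0.trans (hγmono.monotone n.zero_le)).analyticOnNhd
      (isOpen_lt continuous_const continuous_re)
  obtain ⟨c, hac, hcb⟩ := exists_between hab
  have hc : ((c : ℝ) : ℂ) ∈ {z : ℂ | 0 < z.re} := by simpa using ha.trans hac
  have hmap : Tendsto ((↑) : ℝ → ℂ) (nhdsWithin c {c}ᶜ) (nhdsWithin (c : ℂ) {(c : ℂ)}ᶜ) :=
    continuous_ofReal.continuousWithinAt.tendsto_nhdsWithin fun x hx => by simpa using hx
  have hev : ∀ᶠ t : ℝ in nhdsWithin c {c}ᶜ,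
      ∑' n, τ n * Complex.exp (-(γ n : ℂ) * (t : ℂ)) = 0 :=
    eventually_nhdsWithin_of_eventually_nhds <| by
      filter_upwards [Ioo_mem_nhds hac hcb] with t ht using hzero t ht.1 ht.2
  have hvan := han.eqOn_zero_of_preconnected_of_frequently_eq_zero
    (convex_halfSpace_re_gt 0).isPreconnected hc (hmap.frequently hev.frequently)
  intro n
  induction n using Nat.strong_induction_on with
  | _ n ih =>
    refine tendsto_nhds_unique (tendsto_exp_mul_tsum_mul_exp_neg_mul hτ hγmono ih)
      (tendsto_const_nhds.congr' ?_)
    filter_upwards [eventually_gt_atTop 0] with t ht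
    have h := hvan (show (t : ℂ) ∈ {z : ℂ | 0 < z.re} by simpa using ht)
    simp only [Pi.zero_apply] at h
    rw [h, mul_zero]
end

section
/- Let θ₁, θ₂, θ_* ∈ ℝ with θ₁ − θ₂ not a rational multiple of π, and let m be a nonzero integer. If a, b ∈ ℂ satisfy a·e^{i m (θ₁ − θ_*)} + b·e^{-i m (θ₁ − θ_*)} = 0 and a·e^{i m (θ₂ − θ_*)} + b·e^{-i m (θ₂ − θ_*)} = 0, then a = 0 and b = 0. -/
open Complex

/-- Lemma 3.3 core: under the observation condition `θ₁ - θ₂ ∉ π ℚ`, the 2×2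
linear system for the Fourier coefficients has only the trivial solution. -/
theorem two_point_system_trivial
    (θ₁ θ₂ θs : ℝ) (hθ : ∀ q : ℚ, θ₁ - θ₂ ≠ (q : ℝ) * Real.pi)
    (m : ℤ) (hm : m ≠ 0) (a b : ℂ)
    (h₁ : a * Complex.exp (Complex.I * (m : ℂ) * ((θ₁ : ℂ) - (θs : ℂ)))
        + b * Complex.exp (-(Complex.I * (m : ℂ) * ((θ₁ : ℂ) - (θs : ℂ)))) = 0)
    (h₂ : a * Complex.exp (Complex.I * (m : ℂ) * ((θ₂ : ℂ) - (θs : ℂ)))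
        + b * Complex.exp (-(Complex.I * (m : ℂ) * ((θ₂ : ℂ) - (θs : ℂ)))) = 0) :
    a = 0 ∧ b = 0 := by
  have double_exp : ∀ u : ℂ, a * exp u + b * exp (-u) = 0 → a * exp (2 * u) + b = 0 := by
    intro u hu
    have hinv : exp (-u) * exp u = 1 := by rw [← exp_add, neg_add_cancel, exp_zero]
    rw [two_mul, exp_add]
    linear_combination exp u * hu - b * hinv
  have e₁ := double_exp _ h₁
  have e₂ := double_exp _ h₂
  have ha : a = 0 := by
    by_contra ha
    have hexp := mul_left_cancel₀ ha (add_right_cancel (e₁.trans e₂.symm))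
    obtain ⟨n, hn⟩ := exp_eq_exp_iff_exists_int.mp hexp
    have hC : (m : ℂ) * ((θ₁ : ℂ) - θ₂) = n * (Real.pi : ℂ) := by
      apply mul_left_cancel₀ (mul_ne_zero two_ne_zero I_ne_zero)
      linear_combination hn
    have hR : (m : ℝ) * (θ₁ - θ₂) = n * Real.pi := by exact_mod_cast hC
    have hm' : (m : ℝ) ≠ 0 := Int.cast_ne_zero.mpr hm
    apply hθ (n / m)
    push_cast
    field_simp
    linear_combination hR
  exact ⟨ha, by simpa [ha] using e₁⟩
end
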